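/- Consider two one-iteration SPSA experiments for the same quadratic loss L, starting point θ₀ and target θ*: in the first, the coordinates of Δ are i.i.d. with the segmented uniform law μ_S and the gains are a_S > 0 and c_S > 0; in the second, the coordinates of Δ are i.i.d. with the Bernoulli ±1 law μ_B and the gains are a_B > 0 and c_B > 0; in each experiment the noises ε⁺, ε⁻ are square-integrable with mean 0 and variance σ², and Δ, ε⁺, ε⁻ are mutually independent. If ( ((100p − 39)/61)·a_S² − p·a_B² )·‖g‖² + (a_S − a_B)·( p·σ²·(a_S + a_B)/(2c_B²) − 2·⟨θ₀ − θ*, g⟩ ) − p·a_S²·σ²·( 1/(2c_B²) − 50/(61·c_S²) ) < 0, then the segmented uniform distribution produces a strictly smaller mean squared error: E_S‖θ̂₁ − θ*‖² < E_B‖θ̂₁ − θ*‖². (Corollary A.2.) -/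

import Mathlib

open MeasureTheory Real Matrix

/-- The support of the segmented uniform distribution. -/
noncomputable def suSet : Set ℝ :=
  Set.Ioo (-((19 + 3 * Real.sqrt 13) / 20)) (-((19 - 3 * Real.sqrt 13) / 20)) ∪
    Set.Ioo ((19 - 3 * Real.sqrt 13) / 20) ((19 + 3 * Real.sqrt 13) / 20)

/-- The segmented uniform distribution: normalized Lebesgue measure on `suSet`. -/
noncomputable def suMeasure : Measure ℝ := (volume suSet)⁻¹ • volume.restrict suSet

/-- The Bernoulli ±1 distribution `(1/2)(δ₋₁ + δ₁)`. -/
noncomputable def bernoulliPM : Measure ℝ :=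
  (2⁻¹ : ENNReal) • (Measure.dirac (-1) + Measure.dirac 1)

/-- If `N` is centred, then `A + B N` with `N` independent of `A` and `B` has second moment
`E A² + E B² · E N²`. -/
lemma integral_prod_sq_add_mul {α β : Type*} [MeasurableSpace α] [MeasurableSpace β]
    {μ : Measure α} {ν : Measure β} [IsProbabilityMeasure μ] [IsProbabilityMeasure ν]
    {A B : α → ℝ} {N : β → ℝ} (hA : MemLp A 2 μ) (hB : MemLp B 2 μ) (hN : MemLp N 2 ν)
    (hN0 : ∫ y, N y ∂ν = 0) :
    Integrable (fun z : α × β => (A z.1 + B z.1 * N z.2) ^ 2) (μ.prod ν) ∧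
      ∫ z, (A z.1 + B z.1 * N z.2) ^ 2 ∂(μ.prod ν) =
        ∫ x, A x ^ 2 ∂μ + (∫ x, B x ^ 2 ∂μ) * ∫ y, N y ^ 2 ∂ν := by
  have hexp : (fun z : α × β => (A z.1 + B z.1 * N z.2) ^ 2) = fun z =>
      A z.1 ^ 2 * 1 + (2 * (A z.1 * B z.1)) * N z.2 + B z.1 ^ 2 * N z.2 ^ 2 := by
    ext z; ring
  have h1 : Integrable (fun z : α × β => A z.1 ^ 2 * (1 : ℝ)) (μ.prod ν) :=
    hA.integrable_sq.mul_prod (integrable_const _)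
  have h2 : Integrable (fun z : α × β => (2 * (A z.1 * B z.1)) * N z.2) (μ.prod ν) :=
    ((hA.integrable_mul hB).const_mul 2).mul_prod (hN.integrable one_le_two)
  have h3 : Integrable (fun z : α × β => B z.1 ^ 2 * N z.2 ^ 2) (μ.prod ν) :=
    hB.integrable_sq.mul_prod hN.integrable_sq
  have h12 : Integrable (fun z : α × β => A z.1 ^ 2 * (1 : ℝ) + (2 * (A z.1 * B z.1)) * N z.2)
      (μ.prod ν) := h1.add h2
  rw [hexp]
  refine ⟨h12.add h3, ?_⟩
  rw [integral_add h12 h3, integral_add h1 h2,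
    integral_prod_mul (fun x => A x ^ 2) (fun _ => (1 : ℝ)),
    integral_prod_mul (fun x => 2 * (A x * B x)) N,
    integral_prod_mul (fun x => B x ^ 2) (fun y => N y ^ 2), hN0]
  simp

section Perturbation

variable {ι : Type*} [Fintype ι] {μ : Measure ℝ} [IsProbabilityMeasure μ]

lemma memLp_eval_pi {f : ℝ → ℝ} (hf : MemLp f ⊤ μ) (i : ι) :
    MemLp (fun x : ι → ℝ => f (x i)) ⊤ (Measure.pi fun _ : ι => μ) :=
  hf.comp_measurePreserving (measurePreserving_eval (fun _ : ι => μ) i)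

variable [DecidableEq ι]

lemma integral_pi_mul_inv (h0 : ∀ᵐ x ∂μ, x ≠ 0) (hm : ∫ x, x ∂μ = 0) (i j : ι) :
    ∫ x : ι → ℝ, x j * (x i)⁻¹ ∂(Measure.pi fun _ : ι => μ) = if j = i then 1 else 0 := by
  have hprod : (fun x : ι → ℝ => x j * (x i)⁻¹) = fun x => ∏ l,
      (fun t : ℝ => (if j = l then t else 1) * (if i = l then t⁻¹ else 1)) (x l) := by
    ext x; simp only [Finset.prod_mul_distrib, Finset.prod_ite_eq, Finset.mem_univ, if_true]
  rw [hprod, integral_fintype_prod_eq_prod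
    (f := fun l (t : ℝ) => (if j = l then t else 1) * (if i = l then t⁻¹ else 1))]
  split_ifs with hji
  · subst hji
    refine Finset.prod_eq_one fun l _ => ?_
    by_cases hl : j = l
    · have : (fun t : ℝ => t * t⁻¹) =ᵐ[μ] fun _ => 1 := by
        filter_upwards [h0] with t ht using mul_inv_cancel₀ ht
      simp [hl, integral_congr_ae this]
    · simp [hl]
  · exact Finset.prod_eq_zero (Finset.mem_univ j) (by simp [Ne.symm hji, hm])

lemma integral_pi_mul_mul_inv_sq (h0 : ∀ᵐ x ∂μ, x ≠ 0) (hm : ∫ x, x ∂μ = 0)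
    (hv : ∫ x, x ^ 2 ∂μ = 1) {κ : ℝ} (hκ : ∫ x, (x⁻¹) ^ 2 ∂μ = κ) (i j k : ι) :
    ∫ x : ι → ℝ, x j * x k * (x i)⁻¹ ^ 2 ∂(Measure.pi fun _ : ι => μ) =
      if j = k then (if j = i then 1 else κ) else 0 := by
  have hprod : (fun x : ι → ℝ => x j * x k * (x i)⁻¹ ^ 2) = fun x => ∏ l,
      (fun t : ℝ => (if j = l then t else 1) * (if k = l then t else 1) *
        (if i = l then t⁻¹ ^ 2 else 1)) (x l) := by
    ext x; simp only [Finset.prod_mul_distrib, Finset.prod_ite_eq, Finset.mem_univ, if_true]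
  rw [hprod, integral_fintype_prod_eq_prod
    (f := fun l (t : ℝ) => (if j = l then t else 1) * (if k = l then t else 1) *
        (if i = l then t⁻¹ ^ 2 else 1))]
  split_ifs with hjk hji
  · subst hjk hji
    refine Finset.prod_eq_one fun l _ => ?_
    by_cases hl : j = l
    · have : (fun t : ℝ => t * t * t⁻¹ ^ 2) =ᵐ[μ] fun _ => 1 := by
        filter_upwards [h0] with t ht
        field_simp
      simpa [hl] using integral_congr_ae this
    · simp [hl]
  · subst hjk
    rw [Fintype.prod_eq_mul j i hji]
    · simp_all [Ne.symm hji, ← pow_two]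
    · rintro l ⟨h1, h2⟩
      simp [h1.symm, h2.symm]
  · by_cases hji : j = i
    · subst hji
      exact Finset.prod_eq_zero (Finset.mem_univ k) (by simp [hjk, hm])
    · exact Finset.prod_eq_zero (Finset.mem_univ j) (by simp [Ne.symm hji, Ne.symm hjk, hm])

lemma integral_pi_sq_step (h0 : ∀ᵐ x ∂μ, x ≠ 0) (hid : MemLp (fun x : ℝ => x) ⊤ μ)
    (hinv : MemLp (fun x : ℝ => x⁻¹) ⊤ μ) (hm : ∫ x, x ∂μ = 0)
    (hv : ∫ x, x ^ 2 ∂μ = 1) {κ : ℝ} (hκ : ∫ x, (x⁻¹) ^ 2 ∂μ = κ) (g : ι → ℝ) (a d : ℝ) (i : ι) :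
    ∫ x : ι → ℝ, (d - a * (∑ j, g j * x j) * (x i)⁻¹) ^ 2 ∂(Measure.pi fun _ : ι => μ) =
      d ^ 2 - 2 * a * d * g i + a ^ 2 * (κ * ∑ j, g j ^ 2 + (1 - κ) * g i ^ 2) := by
  have hexp : (fun x : ι → ℝ => (d - a * (∑ j, g j * x j) * (x i)⁻¹) ^ 2) = fun x =>
      d ^ 2 - ∑ j, 2 * a * d * g j * (x j * (x i)⁻¹) +
        ∑ j, ∑ k, a ^ 2 * (g j * g k) * (x j * x k * (x i)⁻¹ ^ 2) := by
    ext x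
    have e1 : ∑ j, 2 * a * d * g j * (x j * (x i)⁻¹) =
        2 * a * d * (∑ j, g j * x j) * (x i)⁻¹ := by
      rw [Finset.mul_sum, Finset.sum_mul]
      exact Finset.sum_congr rfl fun j _ => by ring
    have e2 : ∑ j, ∑ k, a ^ 2 * (g j * g k) * (x j * x k * (x i)⁻¹ ^ 2) =
        a ^ 2 * ((∑ j, g j * x j) * ∑ j, g j * x j) * (x i)⁻¹ ^ 2 := by
      rw [Finset.sum_mul_sum]
      simp only [Finset.mul_sum, Finset.sum_mul]
      exact Finset.sum_congr rfl fun j _ => Finset.sum_congr rfl fun k _ => by ring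
    rw [e1, e2]; ring
  have hx (j : ι) := memLp_eval_pi hid j
  have hy : MemLp (fun x : ι → ℝ => (x i)⁻¹) ⊤ (Measure.pi fun _ : ι => μ) := memLp_eval_pi hinv i
  have i1 (j : ι) : Integrable (fun x : ι → ℝ => 2 * a * d * g j * (x j * (x i)⁻¹))
      (Measure.pi fun _ : ι => μ) :=
    ((hy.mul (r := ⊤) (hx j)).integrable le_top).const_mul _
  have i2 (j k : ι) : Integrable
      (fun x : ι → ℝ => a ^ 2 * (g j * g k) * (x j * x k * (x i)⁻¹ ^ 2))
      (Measure.pi fun _ : ι => μ) := by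
    have h := ((hy.mul (r := ⊤) hy).mul (r := ⊤) ((hx k).mul (r := ⊤) (hx j))).integrable le_top
    refine (h.const_mul (a ^ 2 * (g j * g k))).congr (.of_forall fun x => ?_)
    simp [pow_two]
  have i3 : Integrable (fun x : ι → ℝ => d ^ 2 - ∑ j, 2 * a * d * g j * (x j * (x i)⁻¹))
      (Measure.pi fun _ : ι => μ) :=
    (integrable_const _).sub (integrable_finsetSum _ fun j _ => i1 j)
  rw [hexp, integral_add i3
      (integrable_finsetSum _ fun j _ => integrable_finsetSum _ fun k _ => i2 j k),
    integral_sub (integrable_const _) (integrable_finsetSum _ fun j _ => i1 j),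
    integral_finsetSum _ fun j _ => i1 j,
    integral_finsetSum _ fun j _ => integrable_finsetSum _ fun k _ => i2 j k]
  simp_rw [integral_finsetSum _ fun k _ => i2 _ k, integral_const_mul, integral_pi_mul_inv h0 hm,
    integral_pi_mul_mul_inv_sq h0 hm hv hκ]
  have e3 (j : ι) : a ^ 2 * (g j * g j) * (if j = i then 1 else κ) =
      a ^ 2 * κ * g j ^ 2 + if j = i then a ^ 2 * (1 - κ) * g j ^ 2 else 0 := by
    split_ifs <;> ring
  simp only [mul_ite, mul_one, mul_zero, Finset.sum_ite_eq,
    Finset.sum_ite_eq', Finset.mem_univ, if_true] at e3 ⊢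
  simp [e3, Finset.sum_add_distrib, ← Finset.mul_sum]
  ring

end Perturbation

lemma quadratic_central_difference {ι : Type*} [Fintype ι] {Q : Matrix ι ι ℝ} (hQ : Q.IsSymm)
    (b θ Δ : ι → ℝ) (c : ℝ) :
    (1 / 2 * ((θ + c • Δ) ⬝ᵥ Q.mulVec (θ + c • Δ)) + b ⬝ᵥ (θ + c • Δ)) -
      (1 / 2 * ((θ - c • Δ) ⬝ᵥ Q.mulVec (θ - c • Δ)) + b ⬝ᵥ (θ - c • Δ)) =
      2 * c * ((Q.mulVec θ + b) ⬝ᵥ Δ) := by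
  have hs : θ ⬝ᵥ Q.mulVec Δ = Δ ⬝ᵥ Q.mulVec θ := by
    rw [dotProduct_mulVec, ← mulVec_transpose, hQ.eq, dotProduct_comm]
  simp only [mulVec_add, mulVec_sub, mulVec_smul, add_dotProduct, sub_dotProduct, dotProduct_add,
    dotProduct_sub, dotProduct_smul, smul_dotProduct, smul_eq_mul, hs,
    dotProduct_comm (Q.mulVec θ) Δ]
  ring

/-- Mean squared error of one SPSA step for a quadratic loss, for perturbations with centred i.i.d.
coordinates of unit variance and inverse second moment `κ`. -/
lemma spsa_mse {p : ℕ} {μ : Measure ℝ} [IsProbabilityMeasure μ]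
    (h0 : ∀ᵐ x ∂μ, x ≠ 0) (hid : MemLp (fun x : ℝ => x) ⊤ μ)
    (hinv : MemLp (fun x : ℝ => x⁻¹) ⊤ μ) (hm : ∫ x, x ∂μ = 0)
    (hv : ∫ x, x ^ 2 ∂μ = 1) {κ : ℝ} (hκ : ∫ x, (x⁻¹) ^ 2 ∂μ = κ)
    {Q : Matrix (Fin p) (Fin p) ℝ} (hQ : Q.IsSymm) {b θ₀ θs : Fin p → ℝ}
    {a c : ℝ} (hc : 0 < c) {L : (Fin p → ℝ) → ℝ}
    (hL : ∀ θ, L θ = (1 / 2) * (θ ⬝ᵥ Q.mulVec θ) + b ⬝ᵥ θ)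
    {g : Fin p → ℝ} (hg : g = Q.mulVec θ₀ + b)
    {νp νm : Measure ℝ} [IsProbabilityMeasure νp] [IsProbabilityMeasure νm] {σ : ℝ}
    (hp2 : Integrable (fun x => x ^ 2) νp) (hm2 : Integrable (fun x => x ^ 2) νm)
    (hpm : ∫ x, x ∂νp = 0) (hmm : ∫ x, x ∂νm = 0)
    (hpv : ∫ x, x ^ 2 ∂νp = σ ^ 2) (hmv : ∫ x, x ^ 2 ∂νm = σ ^ 2)
    {θ1 : ((Fin p → ℝ) × ℝ × ℝ) → Fin p → ℝ}
    (hθ1 : ∀ ω i, θ1 ω i = θ₀ i -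
      a / (2 * c) * (L (θ₀ + c • ω.1) - L (θ₀ - c • ω.1) + ω.2.1 - ω.2.2) * (ω.1 i)⁻¹) :
    ∫ ω, ∑ i, (θ1 ω i - θs i) ^ 2 ∂((Measure.pi fun _ : Fin p => μ).prod (νp.prod νm)) =
      ∑ i, (θ₀ i - θs i) ^ 2 - 2 * a * ∑ i, (θ₀ i - θs i) * g i +
        a ^ 2 * ((p * κ + (1 - κ)) * ∑ i, g i ^ 2) + p * (a ^ 2 * σ ^ 2 / (2 * c ^ 2) * κ) := by
  have hLp : MemLp (fun x : ℝ => x) 2 νp :=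
    (memLp_two_iff_integrable_sq measurable_id.aestronglyMeasurable).2 hp2
  have hLm : MemLp (fun x : ℝ => x) 2 νm :=
    (memLp_two_iff_integrable_sq measurable_id.aestronglyMeasurable).2 hm2
  have hN : MemLp (fun y : ℝ × ℝ => y.1 - y.2) 2 (νp.prod νm) :=
    (hLp.comp_measurePreserving measurePreserving_fst).sub
      (hLm.comp_measurePreserving measurePreserving_snd)
  have hN0 : ∫ y : ℝ × ℝ, y.1 - y.2 ∂(νp.prod νm) = 0 := by
    have h1 := (hLp.comp_measurePreserving (measurePreserving_fst (ν := νm))).integrable one_le_two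
    have h2 := (hLm.comp_measurePreserving (measurePreserving_snd (μ := νp))).integrable one_le_two
    refine (integral_sub h1 h2).trans ?_
    simp [integral_fun_fst (fun x : ℝ => x), integral_fun_snd (fun x : ℝ => x),
      hpm, hmm]
  have hN2 : ∫ y : ℝ × ℝ, (y.1 - y.2) ^ 2 ∂(νp.prod νm) = 2 * σ ^ 2 := by
    have h := (integral_prod_sq_add_mul hLp (memLp_const (1 : ℝ)) hLm.neg
      ((integral_neg _).trans (by simp [hmm]))).2
    simp only [Pi.neg_apply, one_mul, ← sub_eq_add_neg, one_pow, neg_sq, hpv, hmv] at h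
    rw [h]; simp; ring
  have hstep (ω : (Fin p → ℝ) × ℝ × ℝ) (i : Fin p) : θ1 ω i - θs i =
      ((θ₀ i - θs i) - a * (∑ j, g j * ω.1 j) * (ω.1 i)⁻¹) +
        (-(a / (2 * c)) * (ω.1 i)⁻¹) * (ω.2.1 - ω.2.2) := by
    rw [hθ1, hL, hL, quadratic_central_difference hQ, ← hg, dotProduct]
    field_simp
    ring
  have hx (j : Fin p) := memLp_eval_pi (ι := Fin p) hid j
  have hy (i : Fin p) : MemLp (fun x : Fin p → ℝ => (x i)⁻¹) ⊤ (Measure.pi fun _ : Fin p => μ) :=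
    memLp_eval_pi hinv i
  have hA (i : Fin p) : MemLp
      (fun x : Fin p → ℝ => (θ₀ i - θs i) - a * (∑ j, g j * x j) * (x i)⁻¹) 2
      (Measure.pi fun _ : Fin p => μ) := by
    have hG := memLp_finsetSum Finset.univ fun j _ => (hx j).const_mul (g j)
    exact ((memLp_const _).sub ((hy i).mul (r := ⊤) (hG.const_mul a))).mono_exponent le_top
  have hB (i : Fin p) : MemLp (fun x : Fin p → ℝ => -(a / (2 * c)) * (x i)⁻¹) 2
      (Measure.pi fun _ : Fin p => μ) :=
    ((hy i).const_mul _).mono_exponent le_top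
  have hinv2 (i : Fin p) : ∫ x : Fin p → ℝ, (-(a / (2 * c)) * (x i)⁻¹) ^ 2
      ∂(Measure.pi fun _ : Fin p => μ) = (a / (2 * c)) ^ 2 * κ := by
    simp_rw [mul_pow, neg_sq]
    rw [integral_const_mul, integral_comp_eval (μ := fun _ : Fin p => μ) (i := i)
      (f := fun t : ℝ => (t⁻¹) ^ 2) (by fun_prop), hκ]
  simp_rw [hstep]
  rw [integral_finsetSum _ fun i _ => (integral_prod_sq_add_mul (hA i) (hB i) hN hN0).1]
  simp_rw [fun i => (integral_prod_sq_add_mul (hA i) (hB i) hN hN0).2,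
    integral_pi_sq_step h0 hid hinv hm hv hκ, hinv2, hN2]
  have e (i : Fin p) : 2 * a * (θ₀ i - θs i) * g i = 2 * a * ((θ₀ i - θs i) * g i) := by ring
  simp only [Finset.sum_add_distrib, Finset.sum_sub_distrib, e, ← Finset.mul_sum,
    Finset.sum_const, Finset.card_univ, Fintype.card_fin, nsmul_eq_mul]
  field_simp

lemma memLp_top_id_and_inv {μ : Measure ℝ} {r R : ℝ} (hr : 0 < r)
    (h : ∀ᵐ x ∂μ, r ≤ |x| ∧ |x| ≤ R) :
    MemLp (fun x : ℝ => x) ⊤ μ ∧ MemLp (fun x : ℝ => x⁻¹) ⊤ μ := by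
  refine ⟨memLp_top_of_bound measurable_id.aestronglyMeasurable R ?_,
    memLp_top_of_bound measurable_inv.aestronglyMeasurable r⁻¹ ?_⟩
  · filter_upwards [h] with x hx using hx.2
  · filter_upwards [h] with x hx
    rw [norm_inv]
    exact inv_anti₀ hr hx.1

lemma segment_endpoints : 0 < (19 - 3 * √13) / 20 ∧
    (19 - 3 * √13) / 20 < (19 + 3 * √13) / 20 := by
  have h : √13 * √13 = 13 := Real.mul_self_sqrt (by norm_num)
  have h' : 0 < √13 := Real.sqrt_pos.2 (by norm_num)
  constructor <;> nlinarith

lemma disjoint_segments : Disjoint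
    (Set.Ioo (-((19 + 3 * √13) / 20)) (-((19 - 3 * √13) / 20)))
    (Set.Ioo ((19 - 3 * √13) / 20) ((19 + 3 * √13) / 20)) := by
  have h := segment_endpoints
  exact Set.disjoint_left.2 fun x hx hx' => by linarith [hx.2, hx'.1, h.1]

lemma volume_suSet : volume suSet = ENNReal.ofReal (3 * √13 / 5) := by
  rw [suSet, measure_union disjoint_segments measurableSet_Ioo, Real.volume_Ioo, Real.volume_Ioo,
    ← ENNReal.ofReal_add (by linarith [segment_endpoints.2]) (by linarith [segment_endpoints.2])]
  congr 1; ring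

lemma measurableSet_suSet : MeasurableSet suSet := measurableSet_Ioo.union measurableSet_Ioo

instance : IsProbabilityMeasure suMeasure := by
  have h : volume suSet ≠ 0 := by
    rw [volume_suSet]; simp
  exact ⟨by simpa [suMeasure] using
    ENNReal.inv_mul_cancel h (volume_suSet ▸ ENNReal.ofReal_ne_top)⟩

lemma suMeasure_abs_bounds : ∀ᵐ x ∂suMeasure,
    (19 - 3 * √13) / 20 ≤ |x| ∧ |x| ≤ (19 + 3 * √13) / 20 := by
  refine Measure.ae_smul_measure ?_ _
  filter_upwards [ae_restrict_mem measurableSet_suSet] with x hx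
  have h := segment_endpoints
  rcases hx with hx | hx
  · rw [abs_of_neg (by linarith [hx.2])]
    constructor <;> linarith [hx.1, hx.2]
  · rw [abs_of_pos (by linarith [hx.1])]
    exact ⟨hx.1.le, hx.2.le⟩

lemma integral_suMeasure {f : ℝ → ℝ} (hf : IntegrableOn f suSet) :
    ∫ x, f x ∂suMeasure = (3 * √13 / 5)⁻¹ *
      ((∫ x in (-((19 + 3 * √13) / 20))..(-((19 - 3 * √13) / 20)), f x) +
        ∫ x in ((19 - 3 * √13) / 20)..((19 + 3 * √13) / 20), f x) := by
  have h := segment_endpoints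
  rw [suMeasure, integral_smul_measure, volume_suSet, ENNReal.toReal_inv,
    ENNReal.toReal_ofReal (by positivity), smul_eq_mul,
    intervalIntegral.integral_of_le (by linarith), intervalIntegral.integral_of_le h.2.le,
    integral_Ioc_eq_integral_Ioo, integral_Ioc_eq_integral_Ioo, suSet,
    setIntegral_union disjoint_segments measurableSet_Ioo (hf.mono_set Set.subset_union_left)
      (hf.mono_set Set.subset_union_right)]

lemma integrableOn_suSet_of_integrable {f : ℝ → ℝ} (hf : Integrable f suMeasure) :
    IntegrableOn f suSet := by
  refine (integrable_smul_measure (c := (volume suSet)⁻¹) ?_ ?_).1 hf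
  · simp [volume_suSet]
  · simp [volume_suSet]

lemma suMeasure_moments : ∫ x, x ∂suMeasure = 0 ∧ ∫ x, x ^ 2 ∂suMeasure = 1 ∧
    ∫ x, (x⁻¹) ^ 2 ∂suMeasure = 100 / 61 := by
  have h := segment_endpoints
  have hs : √13 ^ 2 = 13 := Real.sq_sqrt (by norm_num)
  have hs0 : 0 < √13 := Real.sqrt_pos.2 (by norm_num)
  obtain ⟨hid, hinv⟩ := memLp_top_id_and_inv h.1 suMeasure_abs_bounds
  refine ⟨?_, ?_, ?_⟩
  · rw [integral_suMeasure (integrableOn_suSet_of_integrable (hid.integrable le_top)), integral_id,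
      integral_id]
    ring
  · rw [integral_suMeasure (integrableOn_suSet_of_integrable
      (hid.mono_exponent (p := 2) le_top).integrable_sq), integral_pow, integral_pow]
    field_simp
    norm_num
    have h4 : √13 ^ 3 = 13 * √13 := by rw [pow_succ, hs]
    ring_nf
    rw [h4]
    ring
  · have e : (fun x : ℝ => (x⁻¹) ^ 2) = fun x => x ^ (-2 : ℤ) := by
      ext x; simp [_root_.zpow_neg]
    rw [integral_suMeasure (integrableOn_suSet_of_integrable
      (hinv.mono_exponent (p := 2) le_top).integrable_sq), e, integral_zpow, integral_zpow]
    · have h1 : (19 - 3 * √13) ≠ 0 := by linarith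
      have h2 : (19 + 3 * √13) ≠ 0 := by linarith
      norm_num
      field_simp
      ring_nf
      linear_combination (2700 * √13) * hs
    · right
      refine ⟨by norm_num, ?_⟩
      rw [Set.uIcc_of_le h.2.le]
      exact fun hx => by linarith [hx.1]
    · right
      refine ⟨by norm_num, ?_⟩
      rw [Set.uIcc_of_le (by linarith)]
      exact fun hx => by linarith [hx.2]

instance : IsProbabilityMeasure bernoulliPM :=
  ⟨by simp [bernoulliPM, ENNReal.inv_two_add_inv_two]⟩

lemma integral_bernoulliPM (f : ℝ → ℝ) : ∫ x, f x ∂bernoulliPM = (f (-1) + f 1) / 2 := by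
  rw [bernoulliPM, integral_smul_measure,
    integral_add_measure (integrable_dirac (by simp)) (integrable_dirac (by simp))]
  simp
  ring

lemma bernoulliPM_abs_bounds : ∀ᵐ x ∂bernoulliPM, 1 ≤ |x| ∧ |x| ≤ 1 := by
  refine Measure.ae_smul_measure ?_ _
  rw [ae_add_measure_iff]
  simp [ae_dirac_eq]

/-- Corollary A.2: for one-iteration SPSA on a quadratic loss, if
`((100p−39)/61 · a_S² − p·a_B²)‖g‖² + (a_S − a_B)(pσ²(a_S+a_B)/(2c_B²) − 2⟨θ₀−θ*, g⟩)
 − p a_S² σ² (1/(2c_B²) − 50/(61 c_S²)) < 0`, then the segmented uniform perturbation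
distribution yields strictly smaller mean squared error than the Bernoulli ±1. -/
theorem stmt_8
    (p : ℕ) (hp : 1 ≤ p)
    (Q : Matrix (Fin p) (Fin p) ℝ) (hQ : Q.IsSymm) (b : Fin p → ℝ)
    (θ₀ θs : Fin p → ℝ)
    (aS cS aB cB : ℝ) (haS : 0 < aS) (hcS : 0 < cS) (haB : 0 < aB) (hcB : 0 < cB)
    (L : (Fin p → ℝ) → ℝ)
    (hL : ∀ θ, L θ = (1 / 2) * (θ ⬝ᵥ Q.mulVec θ) + b ⬝ᵥ θ)
    (g : Fin p → ℝ) (hg : g = Q.mulVec θ₀ + b)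
    (νSp νSm νBp νBm : Measure ℝ)
    [IsProbabilityMeasure νSp] [IsProbabilityMeasure νSm]
    [IsProbabilityMeasure νBp] [IsProbabilityMeasure νBm]
    (σ : ℝ)
    (hSp1 : Integrable (fun x => x) νSp) (hSp2 : Integrable (fun x => x ^ 2) νSp)
    (hSm1 : Integrable (fun x => x) νSm) (hSm2 : Integrable (fun x => x ^ 2) νSm)
    (hBp1 : Integrable (fun x => x) νBp) (hBp2 : Integrable (fun x => x ^ 2) νBp)
    (hBm1 : Integrable (fun x => x) νBm) (hBm2 : Integrable (fun x => x ^ 2) νBm)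
    (hSpm : ∫ x, x ∂νSp = 0) (hSmm : ∫ x, x ∂νSm = 0)
    (hBpm : ∫ x, x ∂νBp = 0) (hBmm : ∫ x, x ∂νBm = 0)
    (hSpv : ∫ x, x ^ 2 ∂νSp = σ ^ 2) (hSmv : ∫ x, x ^ 2 ∂νSm = σ ^ 2)
    (hBpv : ∫ x, x ^ 2 ∂νBp = σ ^ 2) (hBmv : ∫ x, x ^ 2 ∂νBm = σ ^ 2)
    (PS PB : Measure ((Fin p → ℝ) × ℝ × ℝ))
    (hPS : PS = (Measure.pi fun _ : Fin p => suMeasure).prod (νSp.prod νSm))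
    (hPB : PB = (Measure.pi fun _ : Fin p => bernoulliPM).prod (νBp.prod νBm))
    (θ1S θ1B : ((Fin p → ℝ) × ℝ × ℝ) → Fin p → ℝ)
    (hθ1S : ∀ ω i, θ1S ω i = θ₀ i -
      aS / (2 * cS) * (L (θ₀ + cS • ω.1) - L (θ₀ - cS • ω.1) + ω.2.1 - ω.2.2) * (ω.1 i)⁻¹)
    (hθ1B : ∀ ω i, θ1B ω i = θ₀ i -
      aB / (2 * cB) * (L (θ₀ + cB • ω.1) - L (θ₀ - cB • ω.1) + ω.2.1 - ω.2.2) * (ω.1 i)⁻¹)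
    (hcond :
      ((100 * (p : ℝ) - 39) / 61 * aS ^ 2 - (p : ℝ) * aB ^ 2) * (∑ i, g i ^ 2)
        + (aS - aB) * ((p : ℝ) * σ ^ 2 * (aS + aB) / (2 * cB ^ 2)
            - 2 * ∑ i, (θ₀ i - θs i) * g i)
        - (p : ℝ) * aS ^ 2 * σ ^ 2 * (1 / (2 * cB ^ 2) - 50 / (61 * cS ^ 2)) < 0) :
    ∫ ω, ∑ i, (θ1S ω i - θs i) ^ 2 ∂PS < ∫ ω, ∑ i, (θ1B ω i - θs i) ^ 2 ∂PB := by
  obtain ⟨hS1, hS2, hSi⟩ := suMeasure_moments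
  obtain ⟨hSid, hSinv⟩ := memLp_top_id_and_inv segment_endpoints.1 suMeasure_abs_bounds
  obtain ⟨hBid, hBinv⟩ := memLp_top_id_and_inv one_pos bernoulliPM_abs_bounds
  have hS0 : ∀ᵐ x ∂suMeasure, x ≠ 0 := by
    filter_upwards [suMeasure_abs_bounds] with x hx
    exact abs_pos.1 (segment_endpoints.1.trans_le hx.1)
  have hB0 : ∀ᵐ x ∂bernoulliPM, x ≠ 0 := by
    filter_upwards [bernoulliPM_abs_bounds] with x hx
    exact abs_pos.1 (one_pos.trans_le hx.1)
  rw [hPS, hPB, spsa_mse hS0 hSid hSinv hS1 hS2 hSi hQ hcS hL hg hSp2 hSm2 hSpm hSmm hSpv hSmv hθ1S,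
    spsa_mse hB0 hBid hBinv (by simp [integral_bernoulliPM]) (by simp [integral_bernoulliPM])
      (κ := 1) (by simp [integral_bernoulliPM]) hQ hcB hL hg hBp2 hBm2 hBpm hBmm hBpv hBmv hθ1B]
  rw [← sub_neg]
  refine lt_of_eq_of_lt ?_ hcond
  field_simp
  ring
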